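/- Let (x*,λ*) be a saddle point of L, assume β(t) ≡ β > 0 is constant and γδ > 1, and let (x,λ) be a global solution of the perturbed primal-dual dynamical system. Define the ergodic average x̄(t) = (1/(t − t₀)) ∫_{t₀}^{t} x(s) ds for t > t₀. Then |f(x̄(t)) − f(x*)| = O(1/t) and ‖Ax̄(t) − b‖ = O(1/t) as t → ∞. -/

import Mathlib

open scoped RealInnerProductSpace
open MeasureTheory Set

noncomputable def Lagr {n m : ℕ} (f : EuclideanSpace ℝ (Fin n) → ℝ)
    (A : EuclideanSpace ℝ (Fin n) →L[ℝ] EuclideanSpace ℝ (Fin m))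
    (b : EuclideanSpace ℝ (Fin m))
    (x : EuclideanSpace ℝ (Fin n)) (lam : EuclideanSpace ℝ (Fin m)) : ℝ :=
  f x + ⟪lam, A x - b⟫

noncomputable def AugLagr {n m : ℕ} (f : EuclideanSpace ℝ (Fin n) → ℝ)
    (A : EuclideanSpace ℝ (Fin n) →L[ℝ] EuclideanSpace ℝ (Fin m))
    (b : EuclideanSpace ℝ (Fin m)) (σ : ℝ)
    (x : EuclideanSpace ℝ (Fin n)) (lam : EuclideanSpace ℝ (Fin m)) : ℝ :=
  Lagr f A b x lam + σ / 2 * ‖A x - b‖ ^ 2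

def IsSaddlePoint {n m : ℕ} (f : EuclideanSpace ℝ (Fin n) → ℝ)
    (A : EuclideanSpace ℝ (Fin n) →L[ℝ] EuclideanSpace ℝ (Fin m))
    (b : EuclideanSpace ℝ (Fin m))
    (xs : EuclideanSpace ℝ (Fin n)) (ls : EuclideanSpace ℝ (Fin m)) : Prop :=
  ∀ x lam, Lagr f A b xs lam ≤ Lagr f A b xs ls ∧ Lagr f A b xs ls ≤ Lagr f A b x ls

theorem hasDerivWithinAt_integral_Ici {E : Type*} [NormedAddCommGroup E] [NormedSpace ℝ E]
    [CompleteSpace E] {g : ℝ → E} {a : ℝ} (hg : ContinuousOn g (Ici a)) {t : ℝ} (ht : t ∈ Ici a) :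
    HasDerivWithinAt (fun u => ∫ s in a..u, g s) (g t) (Ici a) t := by
  have hcont : Continuous fun s => g (max a s) :=
    hg.comp_continuous (by fun_prop) fun s => le_max_left a s
  have h := (hcont.integral_hasStrictDerivAt a t).hasDerivAt.hasDerivWithinAt (s := Ici a)
  have heq : ∀ u ∈ Ici a, (∫ s in a..u, g s) = ∫ s in a..u, g (max a s) := by
    intro u hu
    refine intervalIntegral.integral_congr fun s hs => ?_
    rw [uIcc_of_le hu] at hs
    simp only [max_eq_right hs.1]
  rw [max_eq_right (mem_Ici.1 ht)] at h
  exact h.congr heq (heq t ht)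

theorem ContinuousOn.intervalIntegrable_of_Ici {E : Type*} [NormedAddCommGroup E] {g : ℝ → E}
    {a t : ℝ} (hg : ContinuousOn g (Ici a)) (ht : a ≤ t) : IntervalIntegrable g volume a t :=
  (hg.mono (by rw [uIcc_of_le ht]; exact Icc_subset_Ici_self)).intervalIntegrable

theorem antitoneOn_Ici_of_hasDerivWithinAt_nonpos {W W' : ℝ → ℝ} {a : ℝ}
    (hW : ∀ t ∈ Ici a, HasDerivWithinAt W (W' t) (Ici a) t) (hW' : ∀ t ∈ Ici a, W' t ≤ 0) :
    AntitoneOn W (Ici a) :=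
  antitoneOn_of_hasDerivWithinAt_nonpos (convex_Ici a) (fun t ht => (hW t ht).continuousWithinAt)
    (fun t ht => (hW t (interior_subset ht)).mono interior_subset)
    (fun t ht => hW' t (interior_subset ht))

/-- A Gronwall-type estimate: a nonnegative energy whose growth rate is integrable stays bounded,
and so does the integral of its dissipation. -/
theorem exists_bound_energy_dissipation {V V' g e : ℝ → ℝ} {a I : ℝ}
    (hV : ∀ t ∈ Ici a, HasDerivWithinAt V (V' t) (Ici a) t)
    (hV0 : ∀ t ∈ Ici a, 0 ≤ V t)
    (hg : ContinuousOn g (Ici a)) (hg0 : ∀ t ∈ Ici a, 0 ≤ g t)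
    (he : ContinuousOn e (Ici a)) (he0 : ∀ t ∈ Ici a, 0 ≤ e t)
    (heI : ∀ t ∈ Ici a, ∫ s in a..t, e s ≤ I)
    (hle : ∀ t ∈ Ici a, V' t ≤ -g t + (1 + V t) * e t) :
    ∃ K, 0 ≤ K ∧ ∀ t ∈ Ici a, V t ≤ K ∧ ∫ s in a..t, g s ≤ K := by
  have ha : a ∈ Ici a := self_mem_Ici
  have hI : 0 ≤ I := by simpa using heI a ha
  set Φ : ℝ → ℝ := fun t => ∫ s in a..t, e s with hΦ
  have hΦd : ∀ t ∈ Ici a, HasDerivWithinAt Φ (e t) (Ici a) t :=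
    fun t ht => hasDerivWithinAt_integral_Ici he ht
  have hΦa : Φ a = 0 := by simp [hΦ]
  have hVM : ∀ t ∈ Ici a, 1 + V t ≤ (1 + V a) * Real.exp I := by
    have hanti : AntitoneOn (fun t => (1 + V t) * Real.exp (-Φ t)) (Ici a) := by
      refine antitoneOn_Ici_of_hasDerivWithinAt_nonpos
        (fun t ht => ((hV t ht).const_add 1).mul (hΦd t ht).neg.exp) fun t ht => ?_
      have := mul_nonneg (sub_nonneg.2 (hle t ht)) (Real.exp_pos (-Φ t)).le
      have := mul_nonneg (hg0 t ht) (Real.exp_pos (-Φ t)).le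
      simp only [Pi.neg_apply]
      nlinarith
    intro t ht
    have h := hanti ha ht ht
    simp only [hΦa, neg_zero, Real.exp_zero, mul_one] at h
    calc 1 + V t = (1 + V t) * Real.exp (-Φ t) * Real.exp (Φ t) := by
          rw [mul_assoc, ← Real.exp_add]; simp
      _ ≤ (1 + V a) * Real.exp I :=
          mul_le_mul h (Real.exp_le_exp.2 (heI t ht)) (Real.exp_pos _).le
            (by linarith [hV0 a ha])
  set M := (1 + V a) * Real.exp I with hM
  have hM0 : 0 ≤ M := by linarith [hVM a ha, hV0 a ha]
  refine ⟨M + V a + M * I, by linarith [hV0 a ha, mul_nonneg hM0 hI], fun t ht => ⟨?_, ?_⟩⟩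
  · linarith [hV0 a ha, mul_nonneg hM0 hI, hVM t ht]
  · have hanti : AntitoneOn (fun t => V t + (∫ s in a..t, g s) - M * Φ t) (Ici a) := by
      refine antitoneOn_Ici_of_hasDerivWithinAt_nonpos
        (fun t ht => ((hV t ht).add (hasDerivWithinAt_integral_Ici hg ht)).sub
          ((hΦd t ht).const_mul M)) fun t ht => ?_
      nlinarith [hle t ht, mul_le_mul_of_nonneg_right (hVM t ht) (he0 t ht)]
    have h := hanti ha ht ht
    simp only [hΦa, intervalIntegral.integral_same] at h
    linarith [hV0 t ht, mul_le_mul_of_nonneg_left (heI t ht) hM0]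

theorem ConvexOn.add_inner_gradient_le {E : Type*} [NormedAddCommGroup E] [InnerProductSpace ℝ E]
    [CompleteSpace E] {f : E → ℝ} (hf : ConvexOn ℝ univ f) {p : E} (hp : DifferentiableAt ℝ f p)
    (q : E) : f p + ⟪gradient f p, q - p⟫ ≤ f q := by
  have hline : ConvexOn ℝ univ (f ∘ AffineMap.lineMap (k := ℝ) p q) := by
    simpa using hf.comp_affineMap (AffineMap.lineMap p q)
  have hd : HasDerivAt (f ∘ AffineMap.lineMap (k := ℝ) p q) ⟪gradient f p, q - p⟫ 0 := by
    have h1 : HasFDerivAt f (fderiv ℝ f p) (AffineMap.lineMap (k := ℝ) p q 0) := by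
      simpa using hp.hasFDerivAt
    have h2 := h1.comp_hasDerivAt (0 : ℝ) AffineMap.hasDerivAt_lineMap
    rwa [hp.hasGradientAt.fderiv_apply] at h2
  have h := hline.le_slope_of_hasDerivAt (mem_univ 0) (mem_univ 1) one_pos hd
  simp only [slope_def_field, Function.comp_apply, AffineMap.lineMap_apply_zero,
    AffineMap.lineMap_apply_one, sub_zero, div_one] at h
  linarith

/-- The inequality of Jensen for time averages of a trajectory. -/
theorem ConvexOn.sub_mul_average_le_integral {E : Type*} [NormedAddCommGroup E]
    [InnerProductSpace ℝ E] [CompleteSpace E] {f : E → ℝ} (hf : ConvexOn ℝ univ f)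
    (hfd : Differentiable ℝ f) {x : ℝ → E} {a t : ℝ} (hat : a < t)
    (hx : ContinuousOn x (Ici a)) :
    (t - a) * f ((1 / (t - a)) • ∫ s in a..t, x s) ≤ ∫ s in a..t, f (x s) := by
  set p := (1 / (t - a)) • ∫ s in a..t, x s with hp
  have hintegral : (∫ s in a..t, x s) = (t - a) • p := by
    rw [hp, smul_smul, mul_one_div_cancel (sub_pos.2 hat).ne', one_smul]
  have hxi := hx.intervalIntegrable_of_Ici hat.le
  have hfi := (hfd.continuous.comp_continuousOn hx).intervalIntegrable_of_Ici hat.le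
  have hli : IntervalIntegrable (fun s => ⟪gradient f p, x s - p⟫) volume a t :=
    (((continuous_const.inner (continuous_id.sub continuous_const)).comp_continuousOn
      hx).intervalIntegrable_of_Ici hat.le)
  have hzero : ∫ s in a..t, ⟪gradient f p, x s - p⟫ = 0 := by
    have h := (innerSL ℝ (gradient f p)).intervalIntegral_comp_comm
      (hxi.sub (intervalIntegrable_const (c := p)))
    simp only [innerSL_apply_apply] at h
    rw [h, intervalIntegral.integral_sub hxi intervalIntegrable_const, hintegral]
    simp
  calc (t - a) * f p = ∫ s in a..t, (f p + ⟪gradient f p, x s - p⟫) := by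
        rw [intervalIntegral.integral_add intervalIntegrable_const hli, hzero]
        simp
    _ ≤ ∫ s in a..t, f (x s) :=
        intervalIntegral.integral_mono_on hat.le (intervalIntegrable_const.add hli) hfi
          fun s _ => hf.add_inner_gradient_le (hfd p) (x s)

/-- The Lyapunov energy of the primal-dual dynamics at position `p`, velocity `v` and
multiplier `l`, relative to the reference point `(p₀, l₀)`. -/
noncomputable def primalDualEnergy {E F : Type*} [NormedAddCommGroup E] [InnerProductSpace ℝ E]
    [NormedAddCommGroup F] [InnerProductSpace ℝ F] (f : E → ℝ) (A : E →L[ℝ] F) (b : F)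
    (γ δ σ β : ℝ) (p₀ : E) (l₀ : F) (p v : E) (l : F) : ℝ :=
  1 / 2 * ‖p - p₀ + δ • v‖ ^ 2 + (γ * δ - 1) / 2 * ‖p - p₀‖ ^ 2 + δ / 2 * ‖l - l₀‖ ^ 2 +
    β * δ ^ 2 * (f p - f p₀ + ⟪l₀, A p - b⟫ + σ / 2 * ‖A p - b‖ ^ 2)

theorem hasDerivWithinAt_primalDualEnergy {E F : Type*} [NormedAddCommGroup E]
    [InnerProductSpace ℝ E] [CompleteSpace E] [NormedAddCommGroup F] [InnerProductSpace ℝ F]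
    [CompleteSpace F] {f : E → ℝ} (hf : Differentiable ℝ f) {A : E →L[ℝ] F} {b : F}
    {γ δ σ β : ℝ} {p₀ : E} {l₀ : F} (hp₀ : A p₀ = b) {S : Set ℝ}
    {t : ℝ} {e : E} {x x' : ℝ → E} {x'' : E} {l : ℝ → F} {l' : F}
    (hx : HasDerivWithinAt x (x' t) S t) (hx' : HasDerivWithinAt x' x'' S t)
    (hl : HasDerivWithinAt l l' S t)
    (hode1 : x'' + γ • x' t =
      -β • (gradient f (x t) + A.adjoint (l t) + σ • A.adjoint (A (x t) - b)) + e)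
    (hode2 : l' = β • (A (x t + δ • x' t) - b)) :
    HasDerivWithinAt (fun t => primalDualEnergy f A b γ δ σ β p₀ l₀ (x t) (x' t) (l t))
      (-((γ * δ - 1) * δ * ‖x' t‖ ^ 2)
        - β * δ * (⟪gradient f (x t), x t - p₀⟫ + ⟪l₀, A (x t) - b⟫ + σ * ‖A (x t) - b‖ ^ 2)
        + δ * ⟪x t - p₀ + δ • x' t, e⟫) S t := by
  have hx'' : x'' = -γ • x' t +
      (-β • (gradient f (x t) + A.adjoint (l t) + σ • A.adjoint (A (x t) - b)) + e) := by
    rw [← hode1]; module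
  have hu := hx.sub_const p₀
  have hz := hu.add (hx'.const_smul δ)
  have hm := hl.sub_const l₀
  have hr := (A.hasFDerivAt.comp_hasDerivWithinAt t hx).sub_const b
  have hfx : HasDerivWithinAt (fun t => f (x t)) ⟪gradient f (x t), x' t⟫ S t := by
    have h := (hf (x t)).hasFDerivAt.comp_hasDerivWithinAt t hx
    rwa [(hf (x t)).hasGradientAt.fderiv_apply] at h
  have hc := hasDerivWithinAt_const t S l₀
  have h := (((hz.norm_sq.const_mul (1 / 2)).add
    (hu.norm_sq.const_mul ((γ * δ - 1) / 2))).add (hm.norm_sq.const_mul (δ / 2))).add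
    ((((hfx.sub_const (f p₀)).add (hc.inner ℝ hr)).add
      (hr.norm_sq.const_mul (σ / 2))).const_mul (β * δ ^ 2))
  refine h.congr_deriv ?_
  subst hp₀
  have hA : A (x t) - A p₀ = A (x t - p₀) := (map_sub A _ _).symm
  have hA' : A (x t + δ • x' t) - A p₀ = A (x t - p₀) + δ • A (x' t) := by
    simp only [map_add, map_sub, map_smul]; module
  rw [hA'] at hode2
  simp only [Function.comp_apply, Pi.add_apply, Pi.smul_apply, hA] at hx'' ⊢
  rw [hx'', hode2]
  generalize x t - p₀ = u
  generalize x' t = v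
  generalize gradient f (x t) = g
  generalize l t = μ
  simp only [← real_inner_self_eq_norm_sq, map_add, map_smul, inner_add_left, inner_add_right,
    inner_sub_left, inner_smul_left, inner_smul_right, ContinuousLinearMap.adjoint_inner_right,
    inner_zero_left, conj_trivial]
  rw [real_inner_comm v u, real_inner_comm u g, real_inner_comm v g, real_inner_comm μ (A u),
    real_inner_comm μ (A v), real_inner_comm (A v) (A u)]
  ring

theorem perturbed_ergodic_rates
    {n m : ℕ}
    (f : EuclideanSpace ℝ (Fin n) → ℝ)
    (hf_conv : ConvexOn ℝ Set.univ f)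
    (hf_smooth : ContDiff ℝ 1 f)
    (A : EuclideanSpace ℝ (Fin n) →L[ℝ] EuclideanSpace ℝ (Fin m))
    (b : EuclideanSpace ℝ (Fin m))
    (t₀ γ δ σ : ℝ) (ht₀ : 0 ≤ t₀) (hγ : 0 < γ) (hδ : 0 < δ) (hσ : 0 < σ)
    (β : ℝ) (hβpos : 0 < β) (hγδ : 1 < γ * δ)
    (xs : EuclideanSpace ℝ (Fin n)) (ls : EuclideanSpace ℝ (Fin m))
    (hsaddle : IsSaddlePoint f A b xs ls)
    (ε : ℝ → EuclideanSpace ℝ (Fin n))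
    (hεcont : ContinuousOn ε (Ici t₀))
    (hεint : IntegrableOn (fun t => ‖ε t‖) (Ici t₀))
    (x x' x'' : ℝ → EuclideanSpace ℝ (Fin n))
    (lam lam' : ℝ → EuclideanSpace ℝ (Fin m))
    (hx : ∀ t ∈ Ici t₀, HasDerivWithinAt x (x' t) (Ici t₀) t)
    (hx' : ∀ t ∈ Ici t₀, HasDerivWithinAt x' (x'' t) (Ici t₀) t)
    (hx''cont : ContinuousOn x'' (Ici t₀))
    (hlam : ∀ t ∈ Ici t₀, HasDerivWithinAt lam (lam' t) (Ici t₀) t)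
    (hlam'cont : ContinuousOn lam' (Ici t₀))
    (hode1 : ∀ t ∈ Ici t₀, x'' t + γ • x' t =
      -β • (gradient f (x t) + A.adjoint (lam t) + σ • A.adjoint (A (x t) - b)) + ε t)
    (hode2 : ∀ t ∈ Ici t₀, lam' t = β • (A (x t + δ • x' t) - b))
    (xbar : ℝ → EuclideanSpace ℝ (Fin n))
    (hxbar : ∀ t, t₀ < t → xbar t = (1 / (t - t₀)) • ∫ s in t₀..t, x s)
    :
    (∃ C T : ℝ, 0 ≤ C ∧ t₀ < T ∧ ∀ t ≥ T, |f (xbar t) - f xs| ≤ C / t) ∧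
    (∃ C T : ℝ, 0 ≤ C ∧ t₀ < T ∧ ∀ t ≥ T, ‖A (xbar t) - b‖ ≤ C / t) := by
  have hAxs : A xs = b := by
    have h := (hsaddle xs (ls + (A xs - b))).1
    simp only [Lagr, inner_add_left] at h
    exact sub_eq_zero.1 (real_inner_self_nonpos.1 (by linarith))
  have hconst : ∀ y, f xs ≤ f y + ⟪ls, A y - b⟫ := fun y => by
    simpa [Lagr, hAxs] using (hsaddle y ls).2
  have hfd : Differentiable ℝ f := hf_smooth.differentiable one_ne_zero
  have hxc : ContinuousOn x (Ici t₀) := fun t ht => (hx t ht).continuousWithinAt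
  have hAxc : ContinuousOn (fun t => A (x t)) (Ici t₀) := A.continuous.comp_continuousOn hxc
  have hrc : ContinuousOn (fun t => A (x t) - b) (Ici t₀) := hAxc.sub continuousOn_const
  have hfc : ContinuousOn (fun t => f (x t)) (Ici t₀) := hfd.continuous.comp_continuousOn hxc
  have hgap : ContinuousOn (fun t => f (x t) - f xs + ⟪ls, A (x t) - b⟫) (Ici t₀) :=
    (hfc.sub continuousOn_const).add (continuousOn_const.inner hrc)
  have hgap0 : ∀ t, 0 ≤ f (x t) - f xs + ⟪ls, A (x t) - b⟫ := fun t => by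
    linarith [hconst (x t)]
  have hβδ : 0 < β * δ := mul_pos hβpos hδ
  set V := fun t => primalDualEnergy f A b γ δ σ β xs ls (x t) (x' t) (lam t) with hVdef
  have hVge : ∀ t, 1 / 2 * ‖x t - xs + δ • x' t‖ ^ 2 + (γ * δ - 1) / 2 * ‖x t - xs‖ ^ 2 +
      δ / 2 * ‖lam t - ls‖ ^ 2 ≤ V t := fun t => by
    have : 0 ≤ β * δ ^ 2 *
        (f (x t) - f xs + ⟪ls, A (x t) - b⟫ + σ / 2 * ‖A (x t) - b‖ ^ 2) :=
      mul_nonneg (by positivity) (add_nonneg (hgap0 t) (by positivity))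
    simp only [hVdef, primalDualEnergy]
    linarith
  have h1 : ∀ t, 0 ≤ 1 / 2 * ‖x t - xs + δ • x' t‖ ^ 2 := fun t => by positivity
  have h2 : ∀ t, 0 ≤ (γ * δ - 1) / 2 * ‖x t - xs‖ ^ 2 := fun t =>
    mul_nonneg (by linarith) (sq_nonneg _)
  have h3 : ∀ t, 0 ≤ δ / 2 * ‖lam t - ls‖ ^ 2 := fun t => by positivity
  obtain ⟨K, hK0, hK⟩ := exists_bound_energy_dissipation (V := V)
    (g := fun t => β * δ * (f (x t) - f xs + ⟪ls, A (x t) - b⟫)) (e := fun t => δ * ‖ε t‖)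
    (I := δ * ∫ s in Ici t₀, ‖ε s‖)
    (fun t ht => hasDerivWithinAt_primalDualEnergy hfd hAxs (hx t ht) (hx' t ht) (hlam t ht)
      (hode1 t ht) (hode2 t ht))
    (fun t _ => by linarith [hVge t, h1 t, h2 t, h3 t])
    (continuousOn_const.mul hgap) (fun t _ => mul_nonneg hβδ.le (hgap0 t))
    (continuousOn_const.mul hεcont.norm) (fun t _ => by positivity)
    (fun t ht => by
      rw [intervalIntegral.integral_const_mul, intervalIntegral.integral_of_le ht]
      exact mul_le_mul_of_nonneg_left (setIntegral_mono_set hεint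
        (.of_forall fun s => norm_nonneg _)
        (Ioc_subset_Ioi_self.trans Ioi_subset_Ici_self).eventuallyLE) hδ.le)
    (fun t _ => by
      have hconv : f (x t) - f xs ≤ ⟪gradient f (x t), x t - xs⟫ := by
        have h := hf_conv.add_inner_gradient_le (hfd (x t)) xs
        rw [← neg_sub (x t) xs, inner_neg_right] at h
        linarith
      have hdamp : 0 ≤ (γ * δ - 1) * δ * ‖x' t‖ ^ 2 :=
        mul_nonneg (mul_nonneg (by linarith) hδ.le) (sq_nonneg _)
      have hdiss := mul_le_mul_of_nonneg_left hconv hβδ.le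
      have hpen : 0 ≤ β * δ * (σ * ‖A (x t) - b‖ ^ 2) := by positivity
      have hnoise : ⟪x t - xs + δ • x' t, ε t⟫ ≤ (1 + V t) * ‖ε t‖ :=
        (real_inner_le_norm _ _).trans <| mul_le_mul_of_nonneg_right
          (by nlinarith [hVge t, h2 t, h3 t, sq_nonneg (‖x t - xs + δ • x' t‖ - 1)])
          (norm_nonneg _)
      linarith [mul_le_mul_of_nonneg_left hnoise hδ.le])
  obtain ⟨R, hR0, hR⟩ : ∃ R, 0 ≤ R ∧ ∀ t ∈ Ici t₀, ‖A (x t) - b‖ ≤ R := by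
    refine ⟨‖A‖ * √(K / ((γ * δ - 1) / 2)), by positivity, fun t ht => ?_⟩
    rw [← hAxs, ← map_sub]
    refine (A.le_opNorm _).trans (mul_le_mul_of_nonneg_left (Real.le_sqrt_of_sq_le ?_)
      (norm_nonneg _))
    rw [le_div_iff₀ (by linarith)]
    linarith [hVge t, h1 t, h3 t, (hK t ht).1]
  obtain ⟨Q, hQ0, hQ⟩ : ∃ Q, 0 ≤ Q ∧ ∀ t ∈ Ici t₀, ‖lam t - ls‖ ≤ Q := by
    refine ⟨√(K / (δ / 2)), by positivity, fun t ht => Real.le_sqrt_of_sq_le ?_⟩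
    rw [le_div_iff₀ (by linarith)]
    linarith [hVge t, h1 t, h2 t, (hK t ht).1]
  have hres : ∀ t, t₀ < t → (t - t₀) * ‖A (xbar t) - b‖ ≤ (2 * Q + β * δ * (2 * R)) / β := by
    intro t ht
    have ht0 : (0 : ℝ) < t - t₀ := sub_pos.2 ht
    have hintegral : ∫ s in t₀..t, β • (A (x s) - b) =
        (lam t - (β * δ) • (A (x t) - b)) - (lam t₀ - (β * δ) • (A (x t₀) - b)) := by
      have hd : ∀ s ∈ Ici t₀, HasDerivWithinAt (fun s => lam s - (β * δ) • (A (x s) - b))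
          (β • (A (x s) - b)) (Ici t₀) s := fun s hs => by
        refine ((hlam s hs).sub (((A.hasFDerivAt.comp_hasDerivWithinAt s (hx s hs)).sub_const
          b).const_smul (β * δ))).congr_deriv ?_
        rw [hode2 s hs, map_add, map_smul]
        module
      exact intervalIntegral.integral_eq_sub_of_hasDerivAt_of_le ht.le
        (fun s hs => ((hd s hs.1).mono Icc_subset_Ici_self).continuousWithinAt)
        (fun s hs => (hd s hs.1.le).hasDerivAt (Ici_mem_nhds hs.1))
        ((hrc.const_smul β).intervalIntegrable_of_Ici ht.le)
    have hscale : ∫ s in t₀..t, β • (A (x s) - b) = (β * (t - t₀)) • (A (xbar t) - b) := by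
      rw [intervalIntegral.integral_smul, intervalIntegral.integral_sub
        (hAxc.intervalIntegrable_of_Ici ht.le)
        intervalIntegrable_const, A.intervalIntegral_comp_comm
        (hxc.intervalIntegrable_of_Ici ht.le), intervalIntegral.integral_const, hxbar t ht,
        map_smul, mul_smul, smul_sub (t - t₀), smul_smul (t - t₀),
        mul_one_div_cancel ht0.ne', one_smul]
    have hbound : ‖(β * (t - t₀)) • (A (xbar t) - b)‖ ≤ 2 * Q + β * δ * (2 * R) := by
      rw [← hscale, hintegral]
      have heq : (lam t - (β * δ) • (A (x t) - b)) - (lam t₀ - (β * δ) • (A (x t₀) - b)) =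
          ((lam t - ls) - (lam t₀ - ls)) -
            (β * δ) • ((A (x t) - b) - (A (x t₀) - b)) := by module
      rw [heq]
      refine (norm_sub_le _ _).trans (add_le_add ?_ ?_)
      · linarith [norm_sub_le (lam t - ls) (lam t₀ - ls), hQ t ht.le, hQ t₀ self_mem_Ici]
      · rw [norm_smul, Real.norm_of_nonneg hβδ.le]
        refine mul_le_mul_of_nonneg_left ?_ hβδ.le
        linarith [norm_sub_le (A (x t) - b) (A (x t₀) - b), hR t ht.le, hR t₀ self_mem_Ici]
    rw [norm_smul, Real.norm_of_nonneg (by positivity)] at hbound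
    rw [le_div_iff₀ hβpos]
    linarith
  have hgapbar : ∀ t, t₀ < t →
      (t - t₀) * (f (xbar t) - f xs + ⟪ls, A (xbar t) - b⟫) ≤ K / (β * δ) := by
    intro t ht
    have hconv : ConvexOn ℝ univ fun y => f y - f xs + ⟪ls, A y - b⟫ := by
      have hlin := (((innerSL ℝ ls).comp A).toLinearMap.convexOn (convex_univ (𝕜 := ℝ)))
      refine ((hf_conv.add hlin).add_const (-f xs - ⟪ls, b⟫)).congr fun y _ => ?_
      simp [inner_sub_right]
      ring
    have hdiff : Differentiable ℝ fun y => f y - f xs + ⟪ls, A y - b⟫ :=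
      (hfd.sub_const _).add ((differentiable_const _).inner ℝ (A.differentiable.sub_const b))
    have h := hconv.sub_mul_average_le_integral hdiff ht hxc
    rw [← hxbar t ht] at h
    refine h.trans ?_
    rw [le_div_iff₀ hβδ, mul_comm, ← intervalIntegral.integral_const_mul]
    exact (hK t ht.le).2
  have hrate : ∀ {c C t : ℝ}, 0 ≤ c → 2 * t₀ + 1 ≤ t → (t - t₀) * c ≤ C → c ≤ 2 * C / t := by
    intro c C t hc ht h
    rw [le_div_iff₀ (by linarith)]
    nlinarith
  set C := (2 * Q + β * δ * (2 * R)) / β with hC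
  have hC0 : 0 ≤ C := by positivity
  refine ⟨⟨2 * (K / (β * δ) + ‖ls‖ * C), 2 * t₀ + 1, by positivity, by linarith, fun t ht => ?_⟩,
    ⟨2 * C, 2 * t₀ + 1, by positivity, by linarith, fun t ht =>
      hrate (norm_nonneg _) ht (hres t (by linarith))⟩⟩
  refine hrate (abs_nonneg _) ht ?_
  have htt : t₀ < t := by linarith [ht.le]
  have ht0 : 0 ≤ t - t₀ := by linarith
  have hinner := mul_le_mul_of_nonneg_left (abs_real_inner_le_norm ls (A (xbar t) - b)) ht0
  have hr := mul_le_mul_of_nonneg_left (hres t htt) (norm_nonneg ls)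
  have hg := hgapbar t htt
  have hg0 : 0 ≤ f (xbar t) - f xs + ⟪ls, A (xbar t) - b⟫ := by linarith [hconst (xbar t)]
  have habs : |f (xbar t) - f xs| ≤
      (f (xbar t) - f xs + ⟪ls, A (xbar t) - b⟫) + |⟪ls, A (xbar t) - b⟫| := by
    rw [abs_le]
    constructor <;> linarith [le_abs_self ⟪ls, A (xbar t) - b⟫,
      neg_abs_le ⟪ls, A (xbar t) - b⟫]
  linarith [mul_le_mul_of_nonneg_left habs ht0]
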